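/- Let T be a tree with at least three vertices that is the graph of an outer local flat folding of a convex k-gon. Then the spine of T has at most k leaves. -/

import Mathlib

noncomputable section

open Set

/-- The closed half-plane bounded by the line through `p` with direction `d`,
lying on the counterclockwise side of that line. -/
def closedHalfPlane (p d : ℂ) : Set ℂ := {z : ℂ | 0 ≤ ((z - p) * starRingEnd ℂ d).im}

/-- The closed wedge with apex `p` spanned by the directions with angles in `[α, β]`. -/
def wedge (p : ℂ) (α β : ℝ) : Set ℂ :=
  {z : ℂ | ∃ r : ℝ, 0 ≤ r ∧ ∃ t : ℝ, α ≤ t ∧ t ≤ β ∧ z = p + r * Complex.exp (t * Complex.I)}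

/-- Euclidean three-dimensional space. -/
abbrev Space3 := EuclideanSpace ℝ (Fin 3)

/-- Vertical projection from three-dimensional space to the plane. -/
def proj2 (q : Space3) : ℂ := ⟨q 0, q 1⟩


/-- `p` is an *unfolded point* of the folding `φ` of the sheet `K`: `φ` agrees with a Euclidean
isometry on the intersection of `K` with some neighborhood of `p`. -/
def UnfoldedPtOn (K : Set ℂ) (φ : ℂ → ℂ) (p : ℂ) : Prop :=
  ∃ U ∈ nhds p, ∃ f : ℂ ≃ᵢ ℂ, Set.EqOn φ ⇑f (U ∩ K)

/-- `p` is a *crease point* of the folding `φ` of the sheet `K`: near `p`, the sheet is covered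
by the two closed half-planes bounded by a line through `p`, with `φ` agreeing with two
distinct isometries on the two halves. -/
def CreasePtOn (K : Set ℂ) (φ : ℂ → ℂ) (p : ℂ) : Prop :=
  ∃ U ∈ nhds p, ∃ d : ℂ, d ≠ 0 ∧ ∃ f₁ f₂ : ℂ ≃ᵢ ℂ, f₁ ≠ f₂ ∧
    Set.EqOn φ ⇑f₁ (U ∩ K ∩ closedHalfPlane p d) ∧
    Set.EqOn φ ⇑f₂ (U ∩ K ∩ closedHalfPlane p (-d))

/-- `p` is a *vertex point* of the folding `φ` of the sheet `K`: near `p`, the sheet is covered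
by finitely many (at least three) closed wedges with apex `p`, with `φ` agreeing with an
isometry on each wedge and at least three distinct isometries occurring. -/
def VertexPtOn (K : Set ℂ) (φ : ℂ → ℂ) (p : ℂ) : Prop :=
  ∃ U ∈ nhds p, ∃ n : ℕ, 3 ≤ n ∧ ∃ (α β : Fin n → ℝ) (f : Fin n → ℂ ≃ᵢ ℂ),
    (∀ i, α i < β i) ∧ (U ∩ K) ⊆ ⋃ i, wedge p (α i) (β i) ∧
    (∀ i, Set.EqOn φ ⇑(f i) (U ∩ K ∩ wedge p (α i) (β i))) ∧
    3 ≤ (Set.range f).ncard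

/-- An *outer local flat folding* of a compact convex region `K`: every point of `K` is an
unfolded point, a crease point, or a vertex point, and all vertex points lie on the boundary
of `K`. -/
structure IsOuterLocalFlatFolding (K : Set ℂ) (φ : ℂ → ℂ) : Prop where
  compact : IsCompact K
  convex : Convex ℝ K
  interior_nonempty : (interior K).Nonempty
  continuousOn : ContinuousOn φ K
  classify : ∀ p ∈ K, UnfoldedPtOn K φ p ∨ CreasePtOn K φ p ∨ VertexPtOn K φ p
  vertex_boundary : ∀ p ∈ K, VertexPtOn K φ p → p ∈ frontier K

/-- The creases of an outer folding are chords of `K`: `u` and `v` are boundary points, the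
open segment between them passes through the interior of `K`, and consists of crease points. -/
def IsCreaseOf (K : Set ℂ) (φ : ℂ → ℂ) (u v : ℂ) : Prop :=
  u ∈ frontier K ∧ v ∈ frontier K ∧ u ≠ v ∧
  openSegment ℝ u v ⊆ interior K ∧
  ∀ z ∈ openSegment ℝ u v, CreasePtOn K φ z

/-- An *outer global flat folding*: an outer local flat folding that, for every `ε > 0`, is
`ε`-close to the vertical projection of a topological embedding of `K` into space. -/
def IsOuterGlobalFlatFolding (K : Set ℂ) (φ : ℂ → ℂ) : Prop :=
  IsOuterLocalFlatFolding K φ ∧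
  ∀ ε : ℝ, 0 < ε → ∃ ψ : ℂ → Space3,
    Topology.IsEmbedding (fun p : K => ψ ↑p) ∧ ∀ p ∈ K, dist (φ p) (proj2 (ψ p)) ≤ ε

/-- `C` is one of the two regions into which the segment `uv` divides `K`. -/
def SideRegion (K : Set ℂ) (u v : ℂ) (C : Set ℂ) : Prop :=
  C = K ∩ {z : ℂ | 0 ≤ ((z - u) * starRingEnd ℂ (v - u)).im} ∨
  C = K ∩ {z : ℂ | ((z - u) * starRingEnd ℂ (v - u)).im ≤ 0}

/-- Along the boundary curve of `C` from `u` to `v` (the part of the boundary of `K` on `C`'s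
side), distances from `u` are monotonically increasing and distances from `v` are
monotonically decreasing. -/
def MonotoneBoundaryArc (K : Set ℂ) (u v : ℂ) (C : Set ℂ) : Prop :=
  ∃ γ : ℝ → ℂ, ContinuousOn γ (Set.Icc 0 1) ∧ γ 0 = u ∧ γ 1 = v ∧
    γ '' Set.Icc 0 1 = frontier K ∩ C ∧
    MonotoneOn (fun t => dist u (γ t)) (Set.Icc 0 1) ∧
    AntitoneOn (fun t => dist v (γ t)) (Set.Icc 0 1)

/-- Reflection of the plane across the line through `u` and `v`. -/
def lineReflect (u v z : ℂ) : ℂ := u + (v - u) * starRingEnd ℂ ((z - u) / (v - u))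

/-- A crease `uv` of `φ`, splitting off the region `C` of `K` with monotone boundary arc, is
*safe* when the reflection across the line `uv` of the boundary arc of `C` does not cross any
crease of `φ`. -/
def SafeCrease (K : Set ℂ) (φ : ℂ → ℂ) (u v : ℂ) (C : Set ℂ) : Prop :=
  IsCreaseOf K φ u v ∧ SideRegion K u v C ∧ MonotoneBoundaryArc K u v C ∧
  ∀ p ∈ lineReflect u v '' (frontier K ∩ C), p ∉ segment ℝ u v → ¬ CreasePtOn K φ p

/-- The vertices of the graph of an outer folding: boundary points of `K` lying on creases. -/
def OuterVertex (K : Set ℂ) (φ : ℂ → ℂ) : Type := {p : ℂ // ∃ q : ℂ, IsCreaseOf K φ p q}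

/-- The graph of an outer folding: vertices are boundary points of `K` on creases, and edges
join the two endpoints of each crease. -/
def outerGraph (K : Set ℂ) (φ : ℂ → ℂ) : SimpleGraph (OuterVertex K φ) :=
  SimpleGraph.fromRel fun a b => IsCreaseOf K φ a.1 b.1

/-- `K` is a (closed, solid) square in the plane. -/
def IsSquareRegion (K : Set ℂ) : Prop :=
  ∃ c w : ℂ, w ≠ 0 ∧
    K = (fun z : ℂ => c + w * z) '' {z : ℂ | z.re ∈ Set.Icc 0 1 ∧ z.im ∈ Set.Icc 0 1}


/-- `K` is a convex polygon with `k` vertices (in strictly convex position). -/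
def IsConvexPolygon (K : Set ℂ) (k : ℕ) : Prop :=
  3 ≤ k ∧ ∃ P : Fin k → ℂ, K = convexHull ℝ (Set.range P) ∧
    ∀ i : Fin k, P i ∉ convexHull ℝ (P '' {j : Fin k | j ≠ i})

/-- The leaves of the spine of a tree `T`: the spine consists of the non-leaf vertices of `T`
(vertices of degree different from one), and its leaves are the spine vertices having exactly
one neighbor in the spine. -/
def spineLeaves {V : Type} (T : SimpleGraph V) : Set V :=
  {v : V | (T.neighborSet v).ncard ≠ 1 ∧
    (T.neighborSet v ∩ {w : V | (T.neighborSet w).ncard ≠ 1}).ncard = 1}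

/-- The two-dimensional cross product. -/
def planarCross (a b : ℂ) : ℝ := a.re * b.im - a.im * b.re

theorem mem_closedHalfPlane_iff {p d z : ℂ} :
    z ∈ closedHalfPlane p d ↔ 0 ≤ planarCross d (z - p) := by
  have h : ((z - p) * starRingEnd ℂ d).im = planarCross d (z - p) := by
    simp [planarCross]; ring
  simp [closedHalfPlane, ← h]

theorem planarCross_smul_right (t : ℝ) (a b : ℂ) : planarCross a (t • b) = t * planarCross a b := by
  simp [planarCross]; ring

theorem planarCross_neg_left (a b : ℂ) : planarCross (-a) b = -planarCross a b := by
  simp [planarCross]; ring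

theorem planarCross_add_right (a b c : ℂ) :
    planarCross a (b + c) = planarCross a b + planarCross a c := by
  simp [planarCross]; ring

theorem planarCross_self (a : ℂ) : planarCross a a = 0 := by
  simp [planarCross]; ring

theorem planarCross_swap (a b : ℂ) : planarCross a b = -planarCross b a := by
  simp [planarCross]; ring

theorem planarCross_I_mul (a : ℂ) : planarCross a (Complex.I * a) = Complex.normSq a := by
  simp [planarCross, Complex.normSq_apply]

theorem continuous_cross (a b : ℂ) : Continuous fun z => planarCross a (z - b) := by
  unfold planarCross
  fun_prop

/-- Vectors parallel to a common nonzero vector are parallel. -/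
theorem planarCross_eq_zero_of_common {a b d : ℂ} (hd : d ≠ 0) (ha : planarCross d a = 0)
    (hb : planarCross d b = 0) : planarCross a b = 0 := by
  unfold planarCross at *
  by_contra h
  apply hd
  apply Complex.ext
  · have : d.re * (a.re * b.im - a.im * b.re) = 0 := by linear_combination a.re * hb - b.re * ha
    simpa [h] using this
  · have : d.im * (a.re * b.im - a.im * b.re) = 0 := by linear_combination a.im * hb - b.im * ha
    simpa [h] using this

theorem exists_eq_smul_of_cross_eq_zero {d w : ℂ} (hd : d ≠ 0) (h : planarCross d w = 0) :
    ∃ t : ℝ, w = t • d := by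
  have hn : Complex.normSq d ≠ 0 := by simpa using hd
  refine ⟨(d.re * w.re + d.im * w.im) / Complex.normSq d, ?_⟩
  unfold planarCross at h
  rw [Complex.normSq_apply] at *
  apply Complex.ext
  · rw [Complex.smul_re, smul_eq_mul, div_mul_eq_mul_div, eq_div_iff hn]
    linear_combination -d.im * h
  · rw [Complex.smul_im, smul_eq_mul, div_mul_eq_mul_div, eq_div_iff hn]
    linear_combination d.re * h

/-- Points near the base point on a line through it stay in a given neighborhood. -/
theorem eventually_add_smul_mem {x w : ℂ} {W : Set ℂ} (hW : W ∈ nhds x) :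
    ∀ᶠ t : ℝ in nhds 0, x + t • w ∈ W := by
  have hc : Continuous fun t : ℝ => x + t • w := by fun_prop
  exact hc.continuousAt (by simpa using hW)

theorem exists_pos_add_smul_mem {x w : ℂ} {W : Set ℂ} (hW : W ∈ nhds x) :
    ∃ t : ℝ, 0 < t ∧ x + t • w ∈ W := by
  have h : ∀ᶠ t : ℝ in nhdsWithin 0 (Ioi 0), x + t • w ∈ W :=
    nhdsWithin_le_nhds (eventually_add_smul_mem hW)
  obtain ⟨t, ht, ht'⟩ := (h.and self_mem_nhdsWithin).exists
  exact ⟨t, ht', ht⟩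

theorem IsometryEquiv.apply_add_smul (f : ℂ ≃ᵢ ℂ) (x w : ℂ) (t : ℝ) :
    f (x + t • w) = f x + t • (f (x + w) - f x) := by
  have h := f.toRealAffineIsometryEquiv.toAffineEquiv.apply_lineMap x (x + w) t
  simpa [AffineMap.lineMap_apply, add_comm] using h

/-- Isometries agreeing near a point on one side of a line through it are equal. -/
theorem isometryEquiv_eq_of_eqOn_halfPlane {f g : ℂ ≃ᵢ ℂ} {y d : ℂ} {W : Set ℂ}
    (hW : W ∈ nhds y) (h : EqOn f g (W ∩ closedHalfPlane y d)) : f = g := by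
  have hy : f y = g y := h ⟨mem_of_mem_nhds hW, by simp [mem_closedHalfPlane_iff, planarCross]⟩
  have key : ∀ w, 0 ≤ planarCross d w → f (y + w) = g (y + w) := by
    intro w hw
    obtain ⟨t, ht, htW⟩ := exists_pos_add_smul_mem (w := w) hW
    have h1 := h ⟨htW, by
      rw [mem_closedHalfPlane_iff, add_sub_cancel_left, planarCross_smul_right]; positivity⟩
    rw [IsometryEquiv.apply_add_smul, IsometryEquiv.apply_add_smul, hy, add_right_inj] at h1
    simpa using smul_right_injective ℂ ht.ne' h1
  ext1 z
  obtain ⟨w, rfl⟩ : ∃ w, z = y + w := ⟨z - y, by ring⟩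
  rcases le_total 0 (planarCross d w) with hw | hw
  · exact key w hw
  · have h1 := key (-w) (by
      rw [← neg_one_smul ℝ w, planarCross_smul_right]; linarith)
    have e : -w = (-1 : ℝ) • w := by simp
    rw [e, IsometryEquiv.apply_add_smul, IsometryEquiv.apply_add_smul, hy, add_right_inj] at h1
    simpa using smul_right_injective ℂ (by norm_num : (-1 : ℝ) ≠ 0) h1

/-- A point near which the folding is a single isometry is not a crease point. -/
theorem not_creasePtOn_of_eqOn {K : Set ℂ} {φ : ℂ → ℂ} {y : ℂ} {W : Set ℂ} {f : ℂ ≃ᵢ ℂ}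
    (hW : W ∈ nhds y) (hK : K ∈ nhds y) (h : EqOn φ f W) : ¬ CreasePtOn K φ y := by
  rintro ⟨U, hU, d, -, f₁, f₂, hne, h₁, h₂⟩
  have hN : W ∩ (U ∩ K) ∈ nhds y := Filter.inter_mem hW (Filter.inter_mem hU hK)
  apply hne
  trans f
  · exact isometryEquiv_eq_of_eqOn_halfPlane hN fun z hz => by
      rw [← h₁ ⟨hz.1.2, hz.2⟩, h hz.1.1]
  · exact isometryEquiv_eq_of_eqOn_halfPlane hN fun z hz => by
      rw [← h₂ ⟨hz.1.2, hz.2⟩, h hz.1.1]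

/-- Near an interior crease point, all crease points lie on one line. -/
theorem CreasePtOn.eventually_cross_eq_zero {K : Set ℂ} {φ : ℂ → ℂ} {x : ℂ}
    (hx : CreasePtOn K φ x) (hK : x ∈ interior K) :
    ∃ d ≠ 0, ∀ᶠ y in nhds x, CreasePtOn K φ y → planarCross d (y - x) = 0 := by
  obtain ⟨U, hU, d, hd, f₁, f₂, -, h₁, h₂⟩ := hx
  refine ⟨d, hd, ?_⟩
  have hUK : U ∩ K ∈ nhds x := Filter.inter_mem hU (mem_interior_iff_mem_nhds.1 hK)
  filter_upwards [eventually_mem_nhds_iff.2 hUK] with y hy hc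
  have hKy : K ∈ nhds y := Filter.mem_of_superset hy inter_subset_right
  by_contra hne
  rcases lt_or_gt_of_ne hne with hlt | hgt
  · have hO : {z | planarCross d (z - x) < 0} ∈ nhds y :=
      (isOpen_lt (continuous_cross d x) continuous_const).mem_nhds hlt
    refine not_creasePtOn_of_eqOn (Filter.inter_mem hy hO) hKy (f := f₂) ?_ hc
    intro z hz
    refine h₂ ⟨hz.1, ?_⟩
    have hz2 : planarCross d (z - x) < 0 := hz.2
    rw [mem_closedHalfPlane_iff, planarCross_neg_left]
    linarith
  · have hO : {z | 0 < planarCross d (z - x)} ∈ nhds y :=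
      (isOpen_lt continuous_const (continuous_cross d x)).mem_nhds hgt
    refine not_creasePtOn_of_eqOn (Filter.inter_mem hy hO) hKy (f := f₁) ?_ hc
    intro z hz
    exact h₁ ⟨hz.1, mem_closedHalfPlane_iff.2 (le_of_lt hz.2)⟩

theorem mem_openSegment_iff_smul {u v z : ℂ} :
    z ∈ openSegment ℝ u v ↔ ∃ t : ℝ, 0 < t ∧ t < 1 ∧ z = u + t • (v - u) := by
  rw [openSegment_eq_image']
  constructor
  · rintro ⟨t, ⟨h0, h1⟩, rfl⟩
    exact ⟨t, h0, h1, rfl⟩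
  · rintro ⟨t, h0, h1, rfl⟩
    exact ⟨t, ⟨h0, h1⟩, rfl⟩

theorem eventually_add_smul_mem_openSegment {u v x : ℂ} (hx : x ∈ openSegment ℝ u v) :
    ∀ᶠ t : ℝ in nhds 0, x + t • (v - u) ∈ openSegment ℝ u v := by
  obtain ⟨r, h0, h1, rfl⟩ := mem_openSegment_iff_smul.1 hx
  filter_upwards [Ioo_mem_nhds (show -r < 0 by linarith) (show 0 < 1 - r by linarith)] with t ht
  refine mem_openSegment_iff_smul.2 ⟨r + t, by linarith [ht.1], by linarith [ht.2], ?_⟩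
  rw [add_smul, add_assoc]

namespace IsCreaseOf

variable {K : Set ℂ} {φ : ℂ → ℂ} {u v : ℂ}

theorem symm (h : IsCreaseOf K φ u v) : IsCreaseOf K φ v u := by
  obtain ⟨h1, h2, h3, h4, h5⟩ := h
  rw [openSegment_symm] at h4 h5
  exact ⟨h2, h1, h3.symm, h4, h5⟩

/-- A crease through an interior crease point is parallel to the local fold direction. -/
theorem cross_direction_eq_zero (h : IsCreaseOf K φ u v) {x d : ℂ} (hx : x ∈ openSegment ℝ u v)
    (hd : ∀ᶠ y in nhds x, CreasePtOn K φ y → planarCross d (y - x) = 0) :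
    planarCross d (v - u) = 0 := by
  have h1 : ∀ᶠ t : ℝ in nhdsWithin 0 (Ioi 0), _ :=
    nhdsWithin_le_nhds ((eventually_add_smul_mem_openSegment hx).and
      (eventually_add_smul_mem (w := v - u) hd))
  obtain ⟨t, ⟨ht1, ht2⟩, ht⟩ := (h1.and self_mem_nhdsWithin).exists
  have h2 := ht2 (h.2.2.2.2 _ ht1)
  rw [add_sub_cancel_left, planarCross_smul_right] at h2
  exact (mul_eq_zero.1 h2).resolve_left (ne_of_gt ht)

/-- Creases do not cross transversally. -/
theorem cross_eq_zero_of_mem_openSegment (h : IsCreaseOf K φ u v) {p q x : ℂ}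
    (h' : IsCreaseOf K φ p q) (hx : x ∈ openSegment ℝ u v) (hx' : x ∈ openSegment ℝ p q) :
    planarCross (v - u) (q - p) = 0 := by
  obtain ⟨d, hd, hev⟩ := (h.2.2.2.2 x hx).eventually_cross_eq_zero (h.2.2.2.1 hx)
  exact planarCross_eq_zero_of_common hd (h.cross_direction_eq_zero hx hev)
    (h'.cross_direction_eq_zero hx' hev)

/-- The line through a crease meets the region only in the crease and its endpoints. -/
theorem mem_of_cross_eq_zero (h : IsCreaseOf K φ u v) (hK : Convex ℝ K) {z : ℂ} (hz : z ∈ K)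
    (hc : planarCross (v - u) (z - u) = 0) : z = u ∨ z = v ∨ z ∈ openSegment ℝ u v := by
  obtain ⟨hu, hv, hne, hseg, -⟩ := h
  have hd : v - u ≠ 0 := sub_ne_zero.2 hne.symm
  obtain ⟨t, ht⟩ := exists_eq_smul_of_cross_eq_zero hd hc
  obtain rfl : z = u + t • (v - u) := by rw [← ht]; ring
  set m : ℂ := u + (1 / 2 : ℝ) • (v - u) with hm
  have hmi : m ∈ interior K :=
    hseg (mem_openSegment_iff_smul.2 ⟨1 / 2, by norm_num, by norm_num, rfl⟩)
  have hsub := hK.openSegment_self_interior_subset_interior hz hmi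
  rcases lt_trichotomy t 0 with h0 | rfl | h0
  · refine absurd (hsub ?_) hu.2
    refine mem_openSegment_iff_smul.2 ⟨-t / (1 / 2 - t), by
      apply div_pos <;> linarith, by rw [div_lt_one] <;> linarith, ?_⟩
    have e : m - (u + t • (v - u)) = (1 / 2 - t) • (v - u) := by rw [hm, sub_smul]; abel
    have : (1 / 2 - t) ≠ 0 := by linarith
    rw [e, smul_smul, div_mul_cancel₀ _ this, neg_smul]
    abel
  · simp
  rcases lt_trichotomy t 1 with h1 | rfl | h1
  · exact Or.inr (Or.inr (mem_openSegment_iff_smul.2 ⟨t, h0, h1, rfl⟩))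
  · simp
  · refine absurd (hsub ?_) hv.2
    refine mem_openSegment_iff_smul.2 ⟨(t - 1) / (t - 1 / 2), by
      apply div_pos <;> linarith, by rw [div_lt_one] <;> linarith, ?_⟩
    have e : m - (u + t • (v - u)) = (-(t - 1 / 2)) • (v - u) := by
      rw [hm, neg_smul, sub_smul]; abel
    have : (t - 1 / 2) ≠ 0 := by linarith
    rw [e, smul_smul, mul_neg, div_mul_cancel₀ _ this, neg_smul, sub_smul, one_smul]
    abel

theorem eq_or_eq_of_cross_eq_zero (h : IsCreaseOf K φ u v) (hK : Convex ℝ K) {z : ℂ}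
    (hz : z ∈ K) (hzf : z ∈ frontier K) (hc : planarCross (v - u) (z - u) = 0) : z = u ∨ z = v := by
  rcases h.mem_of_cross_eq_zero hK hz hc with h1 | h1 | h1
  · exact Or.inl h1
  · exact Or.inr h1
  · exact absurd (h.2.2.2.1 h1) hzf.2

/-- A crease leaving the open side of another crease ends at one of its endpoints. -/
theorem eq_or_eq_of_side (h : IsCreaseOf K φ u v) (hK : Convex ℝ K) (hcl : IsClosed K) {p q : ℂ}
    (h' : IsCreaseOf K φ p q) {s : ℝ} (hp : 0 < s * planarCross (v - u) (p - u))
    (hq : s * planarCross (v - u) (q - u) ≤ 0) : q = u ∨ q = v := by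
  rcases hq.lt_or_eq with hlt | heq
  · exfalso
    set A := s * planarCross (v - u) (p - u) with hA
    set B := s * planarCross (v - u) (q - u) with hB
    have hAB : 0 < A - B := by linarith
    have hs : s ≠ 0 := by rintro rfl; simp at hA; linarith
    have hx : p + (A / (A - B)) • (q - p) ∈ openSegment ℝ p q :=
      mem_openSegment_iff_smul.2 ⟨_, by positivity, by rw [div_lt_one] <;> linarith, rfl⟩
    have hdiff : s * planarCross (v - u) (q - p) = B - A := by
      rw [hA, hB]; simp only [planarCross, Complex.sub_re, Complex.sub_im]; ring
    have hx0 : planarCross (v - u) (p + (A / (A - B)) • (q - p) - u) = 0 := by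
      have : s * planarCross (v - u) (p + (A / (A - B)) • (q - p) - u) = 0 := by
        rw [add_sub_right_comm, planarCross_add_right, planarCross_smul_right, mul_add,
          mul_left_comm, hdiff, ← hA]
        field_simp
        ring
      exact (mul_eq_zero.1 this).resolve_left hs
    have hxi := h'.2.2.2.1 hx
    rcases h.mem_of_cross_eq_zero hK (interior_subset hxi) hx0 with h1 | h1 | h1
    · rw [h1] at hxi; exact h.1.2 hxi
    · rw [h1] at hxi; exact h.2.1.2 hxi
    · rw [h.cross_eq_zero_of_mem_openSegment h' h1 hx] at hdiff
      linarith
  · have hs : s ≠ 0 := by rintro rfl; simp at hp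
    exact h.eq_or_eq_of_cross_eq_zero hK (hcl.frontier_subset h'.2.1) h'.2.1
      ((mul_eq_zero.1 heq).resolve_left hs)

/-- Each open side of a crease contains one of the points spanning the region. -/
theorem exists_side_pos {ι : Type*} {P : ι → ℂ} (h : IsCreaseOf K φ u v)
    (hP : K = convexHull ℝ (range P)) {s : ℝ} (hs : s ≠ 0) :
    ∃ i, 0 < s * planarCross (v - u) (P i - u) := by
  by_contra! hcon
  have hsub : K ⊆ {z | s * planarCross (v - u) (z - u) ≤ 0} := by
    rw [hP]
    apply convexHull_min
    · rintro _ ⟨i, rfl⟩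
      exact hcon i
    · intro x hx y hy a b ha hb hab
      have e : s * planarCross (v - u) (a • x + b • y - u) =
          a * (s * planarCross (v - u) (x - u)) + b * (s * planarCross (v - u) (y - u)) := by
        obtain rfl : a = 1 - b := by linarith
        simp [planarCross]; ring
      have hx' : s * planarCross (v - u) (x - u) ≤ 0 := hx
      have hy' : s * planarCross (v - u) (y - u) ≤ 0 := hy
      change s * planarCross (v - u) (a • x + b • y - u) ≤ 0
      rw [e]
      nlinarith
  have hd : v - u ≠ 0 := sub_ne_zero.2 h.2.2.1.symm
  have hm : u + (1 / 2 : ℝ) • (v - u) ∈ interior K :=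
    h.2.2.2.1 (mem_openSegment_iff_smul.2 ⟨1 / 2, by norm_num, by norm_num, rfl⟩)
  obtain ⟨t, ht, htK⟩ := exists_pos_add_smul_mem (w := s • (Complex.I * (v - u)))
    (mem_interior_iff_mem_nhds.1 hm)
  have h1 : s * planarCross (v - u)
      (u + (1 / 2 : ℝ) • (v - u) + t • s • (Complex.I * (v - u)) - u) ≤ 0 := hsub htK
  rw [add_assoc, add_sub_cancel_left, planarCross_add_right, planarCross_smul_right,
    planarCross_smul_right, planarCross_smul_right, planarCross_self, planarCross_I_mul] at h1
  have h2 : 0 < Complex.normSq (v - u) := Complex.normSq_pos.2 hd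
  have h3 : 0 < s ^ 2 := by positivity
  have h4 : 0 < t * (s ^ 2 * Complex.normSq (v - u)) := by positivity
  nlinarith

/-- If the empty caps of two creases overlap, they share their endpoints. -/
theorem eq_or_eq_of_caps_inter {a p q x : ℂ} {s r : ℝ} (hK : Convex ℝ K) (hcl : IsClosed K)
    (h : IsCreaseOf K φ p q) (hu : u ∈ frontier K) (hx : x ∈ K)
    (hp : s * planarCross (a - u) (p - u) ≤ 0) (hq : s * planarCross (a - u) (q - u) ≤ 0)
    (hxs : 0 < s * planarCross (a - u) (x - u)) (hxr : 0 < r * planarCross (q - p) (x - p))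
    (hur : r * planarCross (q - p) (u - p) ≤ 0) : u = p ∨ u = q := by
  have hr : r ≠ 0 := by rintro rfl; simp at hxr
  have huK : u ∈ K := hcl.frontier_subset hu
  rcases hur.lt_or_eq with hlt | heq
  · exfalso
    set A := r * planarCross (q - p) (x - p) with hA
    set B := r * planarCross (q - p) (u - p) with hB
    have hAB : 0 < A - B := by linarith
    set t := -B / (A - B) with ht
    have ht0 : 0 < t := by apply div_pos <;> linarith
    have ht1 : t < 1 := by rw [ht, div_lt_one] <;> linarith
    have hzK : u + t • (x - u) ∈ K :=
      hK.openSegment_subset huK hx (mem_openSegment_iff_smul.2 ⟨t, ht0, ht1, rfl⟩)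
    have hz0 : planarCross (q - p) (u + t • (x - u) - p) = 0 := by
      have : r * planarCross (q - p) (u + t • (x - u) - p) = 0 := by
        trans B + t * (A - B)
        · rw [hA, hB]; simp [planarCross]; ring
        · rw [ht]; field_simp; ring
      exact (mul_eq_zero.1 this).resolve_left hr
    have hzs : 0 < s * planarCross (a - u) (u + t • (x - u) - u) := by
      rw [add_sub_cancel_left, planarCross_smul_right, mul_left_comm]
      positivity
    rcases h.mem_of_cross_eq_zero hK hzK hz0 with h1 | h1 | h1
    · rw [h1] at hzs; linarith
    · rw [h1] at hzs; linarith
    · obtain ⟨c, hc0, hc1, hc⟩ := mem_openSegment_iff_smul.1 h1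
      rw [hc] at hzs
      have e : s * planarCross (a - u) (p + c • (q - p) - u) =
          (1 - c) * (s * planarCross (a - u) (p - u)) + c * (s * planarCross (a - u) (q - u)) := by
        simp [planarCross]; ring
      rw [e] at hzs
      nlinarith
  · exact h.eq_or_eq_of_cross_eq_zero hK huK hu ((mul_eq_zero.1 heq).resolve_left hr)

end IsCreaseOf

/-- Directions in an open half-plane are ordered by slope. -/
theorem exists_slope (f : ℂ →L[ℝ] ℝ) :
    ∃ σ : ℂ → ℝ, ∀ a b : ℂ, f a < 0 → f b < 0 → σ a ≤ σ b → 0 ≤ planarCross a b := by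
  have hf : ∀ z : ℂ, f z = z.re * f 1 + z.im * f Complex.I := by
    intro z
    have : z = z.re • (1 : ℂ) + z.im • Complex.I := by
      apply Complex.ext <;> simp
    conv_lhs => rw [this, map_add, map_smul, map_smul, smul_eq_mul, smul_eq_mul]
  refine ⟨fun z => (z.im * f 1 - z.re * f Complex.I) / f z, fun a b ha hb hab => ?_⟩
  simp only at hab
  rw [← neg_div_neg_eq, ← neg_div_neg_eq (b := f b),
    div_le_div_iff₀ (by linarith) (by linarith)] at hab
  have e : (f 1 ^ 2 + f Complex.I ^ 2) * planarCross a b =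
      f a * (b.im * f 1 - b.re * f Complex.I) - f b * (a.im * f 1 - a.re * f Complex.I) := by
    rw [hf a, hf b]; simp only [planarCross]; ring
  by_contra! hlt
  have hpos : 0 < f 1 ^ 2 + f Complex.I ^ 2 := by
    by_contra! h0
    have h1 : f 1 = 0 := by nlinarith [sq_nonneg (f 1), sq_nonneg (f Complex.I)]
    have h2 : f Complex.I = 0 := by nlinarith [sq_nonneg (f 1), sq_nonneg (f Complex.I)]
    rw [hf a, h1, h2] at ha
    simp at ha
  nlinarith

variable {K : Set ℂ} {φ : ℂ → ℂ}

theorem outerGraph_adj {a b : OuterVertex K φ} :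
    (outerGraph K φ).Adj a b ↔ IsCreaseOf K φ a.1 b.1 := by
  rw [outerGraph, SimpleGraph.fromRel_adj]
  constructor
  · rintro ⟨-, h | h⟩
    exacts [h, h.symm]
  · intro h
    exact ⟨fun e => h.2.2.1 (congrArg Subtype.val e), Or.inl h⟩

/-- A spine leaf has a leaf neighbor joined by an extreme crease. -/
theorem exists_extreme_leaf [Finite (OuterVertex K φ)] (hK : Convex ℝ K) (hcl : IsClosed K)
    {v : OuterVertex K φ} (hv : v ∈ spineLeaves (outerGraph K φ)) :
    ∃ a s, s ≠ 0 ∧ (outerGraph K φ).Adj v a ∧ ((outerGraph K φ).neighborSet a).ncard = 1 ∧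
      ∀ b, (outerGraph K φ).Adj v b → s * planarCross (a.1 - v.1) (b.1 - v.1) ≤ 0 := by
  obtain ⟨hdeg, hspine⟩ := hv
  obtain ⟨w, hw⟩ := Set.ncard_eq_one.1 hspine
  have hwN : w ∈ (outerGraph K φ).neighborSet v := (hw.ge rfl).1
  have hleaf : ∀ a, (outerGraph K φ).Adj v a → a ≠ w →
      ((outerGraph K φ).neighborSet a).ncard = 1 := by
    intro a ha haw
    by_contra hne
    exact haw (hw.le ⟨ha, hne⟩)
  obtain ⟨q, hq⟩ := v.2
  obtain ⟨f, hf⟩ := geometric_hahn_banach_open_point hK.interior isOpen_interior hq.1.2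
  obtain ⟨σ, hσ⟩ := exists_slope f
  have hneg : ∀ a, (outerGraph K φ).Adj v a → f (a.1 - v.1) < 0 := by
    intro a ha
    have hc := outerGraph_adj.1 ha
    have h1 := hf _ (hc.2.2.2.1
      (mem_openSegment_iff_smul.2 ⟨1 / 2, by norm_num, by norm_num, rfl⟩))
    rw [map_add, map_smul, smul_eq_mul] at h1
    linarith
  obtain ⟨a, ha, hamax⟩ := Set.exists_max_image _ (fun a : OuterVertex K φ => σ (a.1 - v.1))
    (Set.toFinite ((outerGraph K φ).neighborSet v)) ⟨w, hwN⟩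
  obtain ⟨b, hb, hbmin⟩ := Set.exists_min_image _ (fun a : OuterVertex K φ => σ (a.1 - v.1))
    (Set.toFinite ((outerGraph K φ).neighborSet v)) ⟨w, hwN⟩
  have hamax' : ∀ c, (outerGraph K φ).Adj v c → 0 ≤ planarCross (c.1 - v.1) (a.1 - v.1) :=
    fun c hc => hσ _ _ (hneg c hc) (hneg a ha) (hamax c hc)
  have hbmin' : ∀ c, (outerGraph K φ).Adj v c → 0 ≤ planarCross (b.1 - v.1) (c.1 - v.1) :=
    fun c hc => hσ _ _ (hneg b hb) (hneg c hc) (hbmin c hc)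
  by_cases haw : a = w
  · by_cases hbw : b = w
    · exfalso
      apply hdeg
      rw [Set.ncard_eq_one]
      refine ⟨w, Set.Subset.antisymm (fun c hc => ?_) (by simpa using hwN)⟩
      have h1 := hamax' c hc
      have h2 := hbmin' c hc
      rw [haw] at h1
      rw [hbw] at h2
      have h3 : planarCross (w.1 - v.1) (c.1 - v.1) = 0 := by
        rw [planarCross_swap] at h1
        linarith
      have hcf := (outerGraph_adj.1 hc).2.1
      rcases (outerGraph_adj.1 hwN).eq_or_eq_of_cross_eq_zero hK (hcl.frontier_subset hcf) hcf h3
        with h4 | h4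
      · exact absurd h4.symm (outerGraph_adj.1 hc).2.2.1
      · exact Subtype.ext h4
    · exact ⟨b, -1, by norm_num, hb, hleaf b hb hbw, fun c hc => by linarith [hbmin' c hc]⟩
  · refine ⟨a, 1, by norm_num, ha, hleaf a ha haw, fun c hc => ?_⟩
    have := hamax' c hc
    rw [planarCross_swap] at this
    linarith

/-- The outer side of an extreme crease to a leaf contains no vertex of the graph. -/
theorem side_nonpos_of_extreme_leaf (hK : Convex ℝ K) (hcl : IsClosed K)
    (hconn : (outerGraph K φ).Connected) {v a : OuterVertex K φ} {s : ℝ}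
    (hva : (outerGraph K φ).Adj v a) (ha : ((outerGraph K φ).neighborSet a).ncard = 1)
    (hs : ∀ b, (outerGraph K φ).Adj v b → s * planarCross (a.1 - v.1) (b.1 - v.1) ≤ 0)
    (p : OuterVertex K φ) : s * planarCross (a.1 - v.1) (p.1 - v.1) ≤ 0 := by
  have hreach := hconn.preconnected v p
  rw [SimpleGraph.reachable_iff_reflTransGen] at hreach
  induction hreach with
  | refl => simp [planarCross]
  | @tail q p _ hqp ih =>
    by_contra! hp
    have hcr := outerGraph_adj.1 hqp
    rcases (outerGraph_adj.1 hva).eq_or_eq_of_side hK hcl hcr.symm hp ih with h | h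
    · obtain rfl : q = v := Subtype.ext h
      exact absurd (hs p hqp) (not_le.2 hp)
    · obtain rfl : q = a := Subtype.ext h
      obtain ⟨c, hc⟩ := Set.ncard_eq_one.1 ha
      have h1 : v = c := hc.le hva.symm
      have h2 : p = c := hc.le hqp
      rw [h2, ← h1] at hp
      simp [planarCross] at hp

theorem ncard_spineLeaves_outerGraph_le [Finite (OuterVertex K φ)] {ι : Type*} [Fintype ι]
    {P : ι → ℂ} (hP : K = convexHull ℝ (range P)) (hK : Convex ℝ K) (hcl : IsClosed K)
    (hconn : (outerGraph K φ).Connected) :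
    (spineLeaves (outerGraph K φ)).ncard ≤ Fintype.card ι := by
  have hex : ∀ v : spineLeaves (outerGraph K φ), ∃ (a : OuterVertex K φ) (s : ℝ) (i : ι),
      (outerGraph K φ).Adj v a ∧ ((outerGraph K φ).neighborSet a).ncard = 1 ∧
      (∀ p : OuterVertex K φ, s * planarCross (a.1 - v.1.1) (p.1 - v.1.1) ≤ 0) ∧
      0 < s * planarCross (a.1 - v.1.1) (P i - v.1.1) := by
    intro v
    obtain ⟨a, s, hs, hva, ha, hside⟩ := exists_extreme_leaf hK hcl v.2
    obtain ⟨i, hi⟩ := (outerGraph_adj.1 hva).exists_side_pos hP hs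
    exact ⟨a, s, i, hva, ha, side_nonpos_of_extreme_leaf hK hcl hconn hva ha hside, hi⟩
  choose a s i hva ha hside hi using hex
  have hinj : Function.Injective i := by
    intro v w hvw
    have hc := outerGraph_adj.1 (hva w)
    have hiK : P (i v) ∈ K := hP ▸ subset_convexHull ℝ _ (mem_range_self _)
    rcases hc.eq_or_eq_of_caps_inter hK hcl (outerGraph_adj.1 (hva v)).1 hiK (hside v _)
      (hside v _) (hi v) (hvw ▸ hi w) (hside w _) with h | h
    · exact Subtype.ext (Subtype.ext h)
    · refine absurd ?_ v.2.1
      rw [show v.1 = a w from Subtype.ext h]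
      exact ha w
  rw [← Nat.card_coe_set_eq, ← Nat.card_eq_fintype_card]
  exact Nat.card_le_card_of_injective i hinj

theorem ncard_spineLeaves_eq_of_iso {V W : Type} {G : SimpleGraph V} {H : SimpleGraph W}
    (e : G ≃g H) : (spineLeaves G).ncard = (spineLeaves H).ncard := by
  have hN : ∀ v, e '' G.neighborSet v = H.neighborSet (e v) := by
    intro v
    ext w
    obtain ⟨u, rfl⟩ := e.surjective w
    simp [e.map_adj_iff]
  have hdeg : ∀ v, (H.neighborSet (e v)).ncard = (G.neighborSet v).ncard := fun v => by
    rw [← hN, Set.ncard_image_of_injective _ e.injective]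
  have himg : e '' {v | (G.neighborSet v).ncard ≠ 1} = {w | (H.neighborSet w).ncard ≠ 1} := by
    ext w
    obtain ⟨u, rfl⟩ := e.surjective w
    rw [e.injective.mem_set_image, Set.mem_ofPred_eq, Set.mem_ofPred_eq, hdeg]
  rw [← Set.ncard_image_of_injective (spineLeaves G) e.injective]
  congr 1
  ext w
  obtain ⟨u, rfl⟩ := e.surjective w
  rw [e.injective.mem_set_image]
  simp only [spineLeaves, Set.mem_ofPred_eq, hdeg]
  rw [← himg, ← hN, ← Set.image_inter e.injective, Set.ncard_image_of_injective _ e.injective]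

theorem stmt17_spine_leaves_bound (V : Type) [Fintype V] (T : SimpleGraph V) (hT : T.IsTree)
    (h3 : 3 ≤ Fintype.card V) (k : ℕ) (K : Set ℂ) (hK : IsConvexPolygon K k)
    (φ : ℂ → ℂ) (hφ : IsOuterLocalFlatFolding K φ)
    (hiso : Nonempty (T ≃g outerGraph K φ)) :
    (spineLeaves T).ncard ≤ k := by
  obtain ⟨e⟩ := hiso
  obtain ⟨-, P, hP, -⟩ := hK
  have : Finite (OuterVertex K φ) := Finite.of_equiv V e.toEquiv
  rw [ncard_spineLeaves_eq_of_iso e, ← Fintype.card_fin k]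
  exact ncard_spineLeaves_outerGraph_le hP hφ.convex hφ.compact.isClosed
    (e.connected_iff.1 hT.connected)
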